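/- arXiv:math/0703042 — 2 statements merged into one kernel-verified Lean document; each statement's English description precedes it below -/
import Mathlib

section
/- Let (𝕏, d) be a Polish space (complete separable metric space) equipped with its Borel σ-algebra, and let (Zₙ) be a sequence of 𝕏-valued random elements on a probability space (Ω, ℱ, P). Then Zₙ converges in probability to some 𝕏-valued random element if and only if for every pair of subsequences (Z_{l(k)}) and (Z_{m(k)}) there exists a further subsequence such that the pair v_k := (Z_{l(j(k))}, Z_{m(j(k))}) converges weakly (in distribution) to an (𝕏 × 𝕏)-valued random element v whose law is supported on the diagonal {(x, y) ∈ 𝕏 × 𝕏 : x = y}. -/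
open MeasureTheory Filter Topology

section

variable {Ω 𝕏 : Type*} [MeasurableSpace Ω] {P : Measure Ω}

/-- If the laws of the pairs `(X k, Y k)` converge weakly to a law carried by the diagonal, then
`dist (X k) (Y k)` converges to zero in probability. -/
theorem tendsto_measure_le_dist_of_weak_limit_diagonal [PseudoMetricSpace 𝕏]
    [SecondCountableTopology 𝕏] [MeasurableSpace 𝕏] [BorelSpace 𝕏] [IsProbabilityMeasure P]
    {X Y : ℕ → Ω → 𝕏} (hX : ∀ n, Measurable (X n)) (hY : ∀ n, Measurable (Y n))
    {ν : Measure (𝕏 × 𝕏)} (hν : ∀ᵐ p ∂ν, p.1 = p.2)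
    (h : ∀ F : BoundedContinuousFunction (𝕏 × 𝕏) ℝ,
      Tendsto (fun k => ∫ ω, F (X k ω, Y k ω) ∂P) atTop (𝓝 (∫ p, F p ∂ν)))
    {ε : ℝ} (hε : 0 < ε) :
    Tendsto (fun k => P {ω | ε ≤ dist (X k ω) (Y k ω)}) atTop (𝓝 0) := by
  let F : BoundedContinuousFunction (𝕏 × 𝕏) ℝ :=
    BoundedContinuousFunction.ofNormedAddCommGroup (fun p => min (dist p.1 p.2) ε)
      (by fun_prop) ε (fun p => by
        rw [Real.norm_of_nonneg (le_min dist_nonneg hε.le)]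
        exact min_le_right _ _)
  have hF : ∀ p, F p = min (dist p.1 p.2) ε := fun _ => rfl
  have hF0 : ∫ p, F p ∂ν = 0 := by
    refine integral_eq_zero_of_ae ?_
    filter_upwards [hν] with p hp
    simp [hF, hp, hε.le]
  have hlim := (h F).div_const ε
  rw [hF0, zero_div] at hlim
  have hreal : Tendsto (fun k => P.real {ω | ε ≤ dist (X k ω) (Y k ω)}) atTop (𝓝 0) := by
    refine squeeze_zero (fun _ => measureReal_nonneg) (fun k => ?_) hlim
    rw [le_div_iff₀ hε, mul_comm]
    have hmeas : Measurable fun ω => F (X k ω, Y k ω) :=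
      F.continuous.measurable.comp ((hX k).prodMk (hY k))
    have hint : Integrable (fun ω => F (X k ω, Y k ω)) P :=
      Integrable.of_bound hmeas.aestronglyMeasurable ‖F‖ (.of_forall fun _ => F.norm_coe_le_norm _)
    have := mul_meas_ge_le_integral_of_nonneg
      (.of_forall fun ω => le_min dist_nonneg hε.le) hint ε
    simpa [hF] using this
  have := ENNReal.tendsto_ofReal hreal
  simpa using this

/-- A first Borel-Cantelli estimate: geometrically small probabilities of geometrically large
distances force almost sure eventual geometric closeness. -/
theorem ae_eventually_dist_lt_two_inv_pow [PseudoMetricSpace 𝕏] {X Y : ℕ → Ω → 𝕏}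
    (h : ∀ k, P {ω | (2⁻¹ : ℝ) ^ k ≤ dist (X k ω) (Y k ω)} ≤ 2⁻¹ ^ k) :
    ∀ᵐ ω ∂P, ∀ᶠ k in atTop, dist (X k ω) (Y k ω) < (2⁻¹ : ℝ) ^ k := by
  have hsum : ∑' k, P {ω | (2⁻¹ : ℝ) ^ k ≤ dist (X k ω) (Y k ω)} ≠ ⊤ := by
    refine ne_top_of_le_ne_top ?_ (ENNReal.tsum_le_tsum h)
    simp [ENNReal.tsum_geometric]
  filter_upwards [ae_eventually_notMem hsum] with ω hω
  filter_upwards [hω] with k hk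
  simpa using hk

/-- A sequence that is Cauchy in probability in a complete space has a measurable limit to which
every subsequence converges almost surely along a further subsequence. -/
theorem exists_limit_forall_subseq_tendsto_ae [PseudoMetricSpace 𝕏] [CompleteSpace 𝕏]
    [MeasurableSpace 𝕏] [BorelSpace 𝕏] {Z : ℕ → Ω → 𝕏} (hZ : ∀ n, Measurable (Z n))
    (h : ∀ ε : ℝ, 0 < ε →
      Tendsto (fun q : ℕ × ℕ => P {ω | ε ≤ dist (Z q.1 ω) (Z q.2 ω)}) atTop (𝓝 0)) :
    ∃ Zlim : Ω → 𝕏, Measurable Zlim ∧ ∀ ns : ℕ → ℕ, Tendsto ns atTop atTop →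
      ∃ ms : ℕ → ℕ, ∀ᵐ ω ∂P, Tendsto (fun k => Z (ns (ms k)) ω) atTop (𝓝 (Zlim ω)) := by
  have hcauchy : ∀ k : ℕ, ∃ N, ∀ n ≥ N, ∀ a ≥ n, ∀ b ≥ n,
      P {ω | (2⁻¹ : ℝ) ^ k ≤ dist (Z a ω) (Z b ω)} ≤ 2⁻¹ ^ k := by
    intro k
    have hpos : (0 : ENNReal) < 2⁻¹ ^ k := ENNReal.pow_pos (by simp) k
    obtain ⟨⟨N₁, N₂⟩, hN⟩ := eventually_atTop.1
      ((h ((2⁻¹ : ℝ) ^ k) (by positivity)).eventually_le_const hpos)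
    refine ⟨max N₁ N₂, fun n hn a ha b hb => hN (a, b) ⟨?_, ?_⟩⟩
    · exact (le_max_left _ _).trans (hn.trans ha)
    · exact (le_max_right _ _).trans (hn.trans hb)
  obtain ⟨φ, hφ, hφP⟩ := extraction_forall_of_eventually' hcauchy
  have hconv : ∀ᵐ ω ∂P, ∃ x, Tendsto (fun k => Z (φ k) ω) atTop (𝓝 x) := by
    filter_upwards [ae_eventually_dist_lt_two_inv_pow (X := fun k => Z (φ k))
      (Y := fun k => Z (φ (k + 1)))
      fun k => hφP k _ le_rfl _ (hφ.monotone k.le_succ)] with ω hω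
    refine cauchySeq_tendsto_of_complete (cauchySeq_of_summable_dist ?_)
    refine Summable.of_norm_bounded_eventually_nat
      (summable_geometric_of_lt_one (by norm_num) (by norm_num : (2⁻¹ : ℝ) < 1)) ?_
    filter_upwards [hω] with k hk
    rw [Real.norm_of_nonneg dist_nonneg]
    exact hk.le
  obtain ⟨Zlim, hZlim, hlim⟩ :=
    measurable_limit_of_tendsto_metrizable_ae (fun k => (hZ (φ k)).aemeasurable) hconv
  refine ⟨Zlim, hZlim, fun ns hns => ?_⟩
  choose ms hms using fun k => (hns.eventually_ge_atTop (φ k)).exists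
  refine ⟨ms, ?_⟩
  filter_upwards [hlim, ae_eventually_dist_lt_two_inv_pow (X := fun k => Z (φ k))
    (Y := fun k => Z (ns (ms k))) fun k => hφP k _ le_rfl _ (hms k)] with ω hω hd
  refine (tendsto_iff_of_dist ?_).1 hω
  refine squeeze_zero' (.of_forall fun _ => dist_nonneg) (hd.mono fun _ hk => hk.le) ?_
  exact tendsto_pow_atTop_nhds_zero_of_lt_one (by norm_num) (by norm_num)

/-- **Gyöngy–Krylov**, topological form of the sufficiency: if every pair of subsequences has a
further subsequence along which the pairs converge weakly to a law carried by the diagonal, there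
is a measurable limit to which every subsequence converges almost surely along a further
subsequence. -/
theorem exists_limit_forall_subseq_tendsto_ae_of_pairs [TopologicalSpace 𝕏] [PolishSpace 𝕏]
    [MeasurableSpace 𝕏] [BorelSpace 𝕏] [IsProbabilityMeasure P]
    {Z : ℕ → Ω → 𝕏} (hZ : ∀ n, Measurable (Z n))
    (h : ∀ l m : ℕ → ℕ, StrictMono l → StrictMono m →
      ∃ j : ℕ → ℕ, StrictMono j ∧
        ∃ ν : Measure (𝕏 × 𝕏), IsProbabilityMeasure ν ∧
          ν {p : 𝕏 × 𝕏 | p.1 = p.2} = 1 ∧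
          ∀ F : BoundedContinuousFunction (𝕏 × 𝕏) ℝ,
            Tendsto (fun k => ∫ ω, F (Z (l (j k)) ω, Z (m (j k)) ω) ∂P) atTop
              (𝓝 (∫ p, F p ∂ν))) :
    ∃ Zlim : Ω → 𝕏, Measurable Zlim ∧ ∀ ns : ℕ → ℕ, Tendsto ns atTop atTop →
      ∃ ms : ℕ → ℕ, ∀ᵐ ω ∂P, Tendsto (fun k => Z (ns (ms k)) ω) atTop (𝓝 (Zlim ω)) := by
  let := TopologicalSpace.upgradeIsCompletelyMetrizable 𝕏
  refine exists_limit_forall_subseq_tendsto_ae hZ fun ε hε => ?_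
  refine tendsto_of_subseq_tendsto fun ns hns => ?_
  rw [← prod_atTop_atTop_eq] at hns
  obtain ⟨φ, hφ, hl⟩ := strictMono_subseq_of_tendsto_atTop hns.fst
  obtain ⟨ψ, hψ, hm⟩ := strictMono_subseq_of_tendsto_atTop (hns.snd.comp hφ.tendsto_atTop)
  obtain ⟨j, -, ν, hν, hdiag, hF⟩ := h _ _ (hl.comp hψ) hm
  have hae : ∀ᵐ p ∂ν, p.1 = p.2 :=
    (mem_ae_iff_prob_eq_one (measurableSet_eq_fun measurable_fst measurable_snd)).2 hdiag
  exact ⟨fun k => φ (ψ (j k)), tendsto_measure_le_dist_of_weak_limit_diagonal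
    (fun _ => hZ _) (fun _ => hZ _) hae hF hε⟩

/-- Convergence in measure expressed with strict inequalities between distances. -/
theorem tendstoInMeasure_iff_lt_dist [PseudoMetricSpace 𝕏] {Z : ℕ → Ω → 𝕏} {Zlim : Ω → 𝕏} :
    TendstoInMeasure P Z atTop Zlim ↔ ∀ η : ℝ, 0 < η →
      Tendsto (fun n => P {ω | η < dist (Z n ω) (Zlim ω)}) atTop (𝓝 0) := by
  rw [tendstoInMeasure_iff_dist]
  constructor
  · intro h η hη
    exact tendsto_of_tendsto_of_tendsto_of_le_of_le tendsto_const_nhds (h η hη)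
      (fun _ => zero_le) fun _ => measure_mono (Set.ofPred_subset_ofPred.2 fun _ hω => le_of_lt hω)
  · intro h η hη
    exact tendsto_of_tendsto_of_tendsto_of_le_of_le tendsto_const_nhds (h (η / 2) (half_pos hη))
      (fun _ => zero_le) fun _ => measure_mono fun _ hω => (half_lt_self hη).trans_le hω

end

/-- **Gyöngy–Krylov lemma.** Let `𝕏` be a Polish space and `(Zₙ)` a sequence of
`𝕏`-valued random elements. Then `Zₙ` converges in probability to some `𝕏`-valued random
element if and only if for every pair of subsequences there is a further (joint)
subsequence whose pairs converge in distribution to a law supported on the diagonal. -/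
theorem convergence_in_probability_iff_pairs_converge_to_diagonal
    {𝕏 : Type*} [MetricSpace 𝕏] [PolishSpace 𝕏] [MeasurableSpace 𝕏] [BorelSpace 𝕏]
    {Ω : Type*} [MeasurableSpace Ω] (P : Measure Ω) [IsProbabilityMeasure P]
    (Z : ℕ → Ω → 𝕏) (hZ : ∀ n, Measurable (Z n)) :
    (∃ Zlim : Ω → 𝕏, Measurable Zlim ∧ ∀ η : ℝ, 0 < η →
        Tendsto (fun n => P {ω | η < dist (Z n ω) (Zlim ω)}) atTop (𝓝 0)) ↔
    (∀ l m : ℕ → ℕ, StrictMono l → StrictMono m →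
      ∃ j : ℕ → ℕ, StrictMono j ∧
        ∃ ν : Measure (𝕏 × 𝕏), IsProbabilityMeasure ν ∧
          ν {p : 𝕏 × 𝕏 | p.1 = p.2} = 1 ∧
          ∀ F : BoundedContinuousFunction (𝕏 × 𝕏) ℝ,
            Tendsto (fun k => ∫ ω, F (Z (l (j k)) ω, Z (m (j k)) ω) ∂P) atTop
              (𝓝 (∫ p, F p ∂ν))) := by
  simp_rw [← tendstoInMeasure_iff_lt_dist]
  constructor
  · rintro ⟨Zlim, hZlim, h⟩ l m hl hm
    obtain ⟨φ, hφ, hlφ⟩ := (h.comp hl.tendsto_atTop).exists_seq_tendsto_ae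
    obtain ⟨ψ, hψ, hmψ⟩ :=
      (h.comp (hm.comp hφ).tendsto_atTop).exists_seq_tendsto_ae
    have hpair : Measurable fun ω => (Zlim ω, Zlim ω) := hZlim.prodMk hZlim
    refine ⟨φ ∘ ψ, hφ.comp hψ, P.map fun ω => (Zlim ω, Zlim ω),
      Measure.isProbabilityMeasure_map hpair.aemeasurable, ?_, fun F => ?_⟩
    · rw [Measure.map_apply hpair (measurableSet_eq_fun measurable_fst measurable_snd)]
      simp
    · rw [integral_map hpair.aemeasurable F.continuous.measurable.aestronglyMeasurable]
      refine tendsto_integral_of_dominated_convergence (fun _ => ‖F‖) (fun k => ?_)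
        (integrable_const _) (fun k => .of_forall fun ω => F.norm_coe_le_norm _) ?_
      · exact (F.continuous.measurable.comp ((hZ _).prodMk (hZ _))).aestronglyMeasurable
      · filter_upwards [hlφ, hmψ] with ω h₁ h₂
        exact (F.continuous.tendsto _).comp
          ((h₁.comp hψ.tendsto_atTop).prodMk_nhds h₂)
  · intro h
    obtain ⟨Zlim, hZlim, hsub⟩ := exists_limit_forall_subseq_tendsto_ae_of_pairs hZ h
    refine ⟨Zlim, hZlim, fun ε hε => tendsto_of_subseq_tendsto fun ns hns => ?_⟩
    obtain ⟨ms, hms⟩ := hsub ns hns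
    exact ⟨ms, tendstoInMeasure_of_tendsto_ae
      (fun k => (hZ (ns (ms k))).aestronglyMeasurable) hms ε hε⟩
end

section
/- Let X, Y, Z be Banach spaces with continuous linear embeddings ι : X → Y and ȷ : Y → Z, where ι is a compact operator and ȷ is injective. Fix T > 0, ρ ∈ (0, 1], and C > 0. Let S be a set of functions u : [0,T] → X such that for every u ∈ S: (i) sup_{t ∈ [0,T]} ‖u(t)‖_X ≤ C; (ii) ∫₀ᵀ ‖u(t)‖²_X dt ≤ C; and (iii) the Z-valued function t ↦ ȷ(ι(u(t))) is ρ-Hölder continuous with ‖ȷ(ι(u(t))) − ȷ(ι(u(r)))‖_Z ≤ C|t − r|^ρ for all t, r ∈ [0,T]. Then the set {t ↦ ι(u(t)) : u ∈ S} is relatively compact in L²(0,T;Y), and the set {t ↦ ȷ(ι(u(t))) : u ∈ S} is relatively compact in C([0,T];Z) with the supremum norm. -/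
open MeasureTheory Filter Topology

/-- A continuous injection of a compact space into a Hausdorff uniform space induces the
uniformity of its domain. -/
theorem Continuous.isUniformInducing_of_compactSpace {α β : Type*} [UniformSpace α]
    [CompactSpace α] [UniformSpace β] [T2Space β] {f : α → β} (hf : Continuous f)
    (hinj : Function.Injective f) : IsUniformInducing f := by
  rw [isUniformInducing_iff_uniformSpace]
  exact unique_uniformity_of_compact (hf.isClosedEmbedding hinj).isInducing.eq_induced.symm rfl

/-- Equicontinuity of a family with values in a compact set can be tested after composition with
a continuous map that is injective on this set. -/
theorem IsCompact.equicontinuous_of_comp {I α β γ : Type*} [TopologicalSpace α] [UniformSpace β]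
    [UniformSpace γ] [T2Space γ] {K : Set β} (hK : IsCompact K) {φ : β → γ}
    (hφ : ContinuousOn φ K) (hinj : Set.InjOn φ K) {F : I → α → β} (hF : ∀ i x, F i x ∈ K)
    (h : Equicontinuous fun i => φ ∘ F i) : Equicontinuous F := by
  have : CompactSpace K := isCompact_iff_compactSpace.1 hK
  have hu : IsUniformInducing (K.domRestrict φ) :=
    hφ.domRestrict.isUniformInducing_of_compactSpace hinj.injective
  have hG : Equicontinuous fun i x => (⟨F i x, hF i x⟩ : K) := hu.equicontinuous_iff.2 h
  exact (isUniformInducing_val K).equicontinuous_iff.1 hG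

/-- A family of functions sharing a Hölder-type bound is equicontinuous. -/
theorem equicontinuous_of_dist_le_mul_rpow {I α β : Type*} [PseudoMetricSpace α]
    [PseudoMetricSpace β] {C ρ : ℝ} (hρ : 0 < ρ) {F : I → α → β}
    (h : ∀ i x y, dist (F i x) (F i y) ≤ C * dist x y ^ ρ) : Equicontinuous F := by
  refine Metric.equicontinuous_of_continuity_modulus (fun s => C * s ^ ρ) ?_ F
    fun x y i => h i x y
  have hc : Continuous fun s : ℝ => C * s ^ ρ :=
    continuous_const.mul (Real.continuous_rpow_const hρ.le)
  simpa [Real.zero_rpow hρ.ne'] using hc.tendsto 0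

/-- **A compactness criterion.** Let `ι : X → Y` be a compact embedding and `j : Y → Z`
an injective continuous embedding of Banach spaces. If a family `S` of functions
`u : [0,T] → X` is uniformly bounded in `X`, with uniformly bounded `L²(0,T;X)` norms,
and the `Z`-valued functions `j(ι(u(·)))` are uniformly `ρ`-Hölder continuous, then
`{ι ∘ u : u ∈ S}` is relatively compact in `L²(0,T;Y)` and `{j ∘ ι ∘ u : u ∈ S}` is
relatively compact in `C([0,T];Z)`. -/
theorem compactness_criterion_holder_bounded
    {X Y Z : Type*}
    [NormedAddCommGroup X] [NormedSpace ℝ X] [CompleteSpace X]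
    [NormedAddCommGroup Y] [NormedSpace ℝ Y] [CompleteSpace Y]
    [NormedAddCommGroup Z] [NormedSpace ℝ Z] [CompleteSpace Z]
    (ι : X →L[ℝ] Y) (hι_cpt : IsCompactOperator ι)
    (j : Y →L[ℝ] Z) (hj_inj : Function.Injective j)
    (T : ℝ) (hT : 0 < T) (ρ : ℝ) (hρ0 : 0 < ρ) (hρ1 : ρ ≤ 1)
    (C : ℝ) (hC : 0 < C)
    (S : Set (ℝ → X))
    (hbdd : ∀ u ∈ S, ∀ t ∈ Set.Icc (0:ℝ) T, ‖u t‖ ≤ C)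
    (hL2 : ∀ u ∈ S, (∫ t in Set.Ioc (0:ℝ) T, ‖u t‖ ^ 2) ≤ C)
    (hHolder : ∀ u ∈ S, ∀ t ∈ Set.Icc (0:ℝ) T, ∀ r ∈ Set.Icc (0:ℝ) T,
      ‖j (ι (u t)) - j (ι (u r))‖ ≤ C * |t - r| ^ ρ) :
    IsCompact (closure {g : Lp Y 2 (volume.restrict (Set.Ioc (0:ℝ) T)) |
        ∃ u ∈ S, (g : ℝ → Y) =ᵐ[volume.restrict (Set.Ioc (0:ℝ) T)] fun t => ι (u t)}) ∧
    IsCompact (closure {g : C(Set.Icc (0:ℝ) T, Z) |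
        ∃ u ∈ S, ∀ t : Set.Icc (0:ℝ) T, g t = j (ι (u ↑t))}) := by
  obtain ⟨K, hK, hKι⟩ := IsCompactOperator.image_closedBall_subset_compact (𝕜₁ := ℝ)
    (f := (ι : X →ₗ[ℝ] Y)) hι_cpt C
  have hmem : ∀ (u : S) (t : Set.Icc (0 : ℝ) T), ι (u.1 t) ∈ K := fun u t =>
    hKι ⟨u.1 t, by simpa using hbdd u u.2 t t.2, rfl⟩
  have hequi : Equicontinuous fun (u : S) (t : Set.Icc (0 : ℝ) T) => ι (u.1 t) := by
    refine hK.equicontinuous_of_comp j.continuous.continuousOn hj_inj.injOn hmem ?_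
    refine equicontinuous_of_dist_le_mul_rpow (C := C) hρ0 fun u t r => ?_
    simpa [dist_eq_norm, Subtype.dist_eq] using hHolder u u.2 t t.2 r r.2
  let A : Set (BoundedContinuousFunction (Set.Icc (0 : ℝ) T) Y) :=
    {f | ∃ u ∈ S, ∀ t : Set.Icc (0 : ℝ) T, f t = ι (u t)}
  have hA : IsCompact (closure A) := by
    refine BoundedContinuousFunction.arzela_ascoli K hK A ?_ ?_
    · rintro f t ⟨u, hu, hf⟩
      exact hf t ▸ hmem ⟨u, hu⟩ t
    · choose u hu hfu using fun f : A => f.2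
      convert! hequi.comp fun f : A => (⟨u f, hu f⟩ : S) using 1
      ext f t
      exact hfu f t
  have hlift : ∀ u ∈ S, ∃ f ∈ A, ∀ t : Set.Icc (0 : ℝ) T, f t = ι (u t) := fun u hu =>
    ⟨BoundedContinuousFunction.mkOfCompact ⟨_, hequi.continuous ⟨u, hu⟩⟩,
      ⟨u, hu, fun _ => rfl⟩, fun _ => rfl⟩
  constructor
  · let p : C(ℝ, Set.Icc (0 : ℝ) T) := ⟨Set.projIcc 0 T hT.le, continuous_projIcc⟩
    have hcont : Continuous fun f : BoundedContinuousFunction (Set.Icc (0 : ℝ) T) Y =>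
        BoundedContinuousFunction.toLp 2 (volume.restrict (Set.Ioc (0 : ℝ) T)) ℝ
          (f.compContinuous p) :=
      (ContinuousLinearMap.continuous _).comp
        (BoundedContinuousFunction.continuous_compContinuous p)
    refine (hA.image hcont).closure_of_subset ?_
    rintro g ⟨u, hu, hg⟩
    obtain ⟨f, hfA, hf⟩ := hlift u hu
    refine ⟨f, subset_closure hfA, Lp.ext ?_⟩
    filter_upwards [BoundedContinuousFunction.coeFn_toLp 2
      (volume.restrict (Set.Ioc (0 : ℝ) T)) ℝ (f.compContinuous p), hg,
      ae_restrict_mem measurableSet_Ioc] with t h₁ h₂ ht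
    rw [h₁, h₂]
    simp [p, hf, Set.projIcc_of_mem hT.le (Set.Ioc_subset_Icc_self ht)]
  · have hcont : Continuous fun f : BoundedContinuousFunction (Set.Icc (0 : ℝ) T) Y =>
        (j : C(Y, Z)).comp f.toContinuousMap :=
      (ContinuousMap.continuous_postcomp _).comp
        (ContinuousMap.isometryEquivBoundedOfCompact _ Y).symm.continuous
    refine (hA.image hcont).closure_of_subset ?_
    rintro g ⟨u, hu, hg⟩
    obtain ⟨f, hfA, hf⟩ := hlift u hu
    refine ⟨f, subset_closure hfA, ContinuousMap.ext fun t => ?_⟩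
    simp [hf, hg]
end
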